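/- Assume the strictly positive gap condition, C_w < ∞, and the interval support condition with parameter W. If (f_0, g_0) and (f_1, g_1) are consistent fixed points consisting of nondecreasing interpolating profiles, then there exists m ∈ ℝ such that f_1(x) = f_0(x+m) and g_1(x) = g_0(x+m) for Lebesgue-almost all x ∈ ℝ; that is, the minimizer is unique up to translation. -/

import Mathlib

open MeasureTheory Filter Set
open scoped ENNReal

noncomputable section

/-- Convolution `(p ⊗ w)(x) = ∫ p(y) w(x-y) dy`. -/
def convw (p w : ℝ → ℝ) (x : ℝ) : ℝ := ∫ y, p y * w (x - y)

/-- `w` is a window: bounded, nonnegative, even, integrable, normalized. -/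
structure IsWindow (w : ℝ → ℝ) : Prop where
  nonneg : ∀ x, 0 ≤ w x
  even : ∀ x, w (-x) = w x
  bounded : ∃ M, ∀ x, w x ≤ M
  integrable : Integrable w
  normalized : (∫ x, w x) = 1

/-- Generalized inverse `h⁻¹(u) = inf {v ∈ [0,1] : h v > u}`. -/
def geninv (h : ℝ → ℝ) (u : ℝ) : ℝ := sInf {v | v ∈ Icc (0:ℝ) 1 ∧ u < h v}

/-- `h` is an update function: nondecreasing from [0,1] to [0,1] with h 0 = 0, h 1 = 1. -/
def IsUpdate (h : ℝ → ℝ) : Prop :=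
  MonotoneOn h (Icc (0:ℝ) 1) ∧ (∀ v ∈ Icc (0:ℝ) 1, h v ∈ Icc (0:ℝ) 1) ∧ h 0 = 0 ∧ h 1 = 1

/-- The potential function φ(u,v). -/
def pot (hf hg : ℝ → ℝ) (u v : ℝ) : ℝ :=
  (∫ u' in (0:ℝ)..u, geninv hg u') + (∫ v' in (0:ℝ)..v, geninv hf v') - u * v

/-- The positive gap condition. -/
def PGC (hf hg : ℝ → ℝ) : Prop :=
  pot hf hg 1 1 = 0 ∧ ∀ u ∈ Icc (0:ℝ) 1, ∀ v ∈ Icc (0:ℝ) 1, 0 ≤ pot hf hg u v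

/-- The strictly positive gap condition. -/
def SPGC (hf hg : ℝ → ℝ) : Prop :=
  pot hf hg 1 1 = 0 ∧ ∀ u ∈ Icc (0:ℝ) 1, ∀ v ∈ Icc (0:ℝ) 1,
    (u, v) ≠ ((0:ℝ), (0:ℝ)) → (u, v) ≠ ((1:ℝ), (1:ℝ)) → 0 < pot hf hg u v

/-- Interpolating profile: takes values in [0,1], tends to 0 at -∞ and to 1 at +∞. -/
def IsProfile (p : ℝ → ℝ) : Prop :=
  (∀ x, p x ∈ Icc (0:ℝ) 1) ∧ Tendsto p atBot (nhds 0) ∧ Tendsto p atTop (nhds 1)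

/-- `H(t) = ∫_0^t h⁻¹`. -/
def Hfun (h : ℝ → ℝ) (t : ℝ) : ℝ := ∫ v in (0:ℝ)..t, geninv h v

/-- The potential functional `W(f,g)`, valued in [0,∞]. -/
def Wfun (w hf hg f g : ℝ → ℝ) : ℝ≥0∞ :=
  ∫⁻ x, ENNReal.ofReal
    (Hfun hg (g x) + convw (fun y => Hfun hf (f y)) w x - convw f w x * g x)

/-- Saturation of a profile `f` at level `K`. -/
def cut (f : ℝ → ℝ) (K : ℝ) (x : ℝ) : ℝ :=
  (if |x| ≤ K then f x else 0) + (if K < x then 1 else 0)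

/-- Left endpoint of the maximal half-line contained in the level set `{x : p x > t}`. -/
def aT (p : ℝ → ℝ) (t : ℝ) : ℝ := sInf {a : ℝ | Ioi a ⊆ {x | t < p x}}

/-- Increasing rearrangement of an interpolating profile. -/
def rearr (p : ℝ → ℝ) (x : ℝ) : ℝ :=
  (volume {t : ℝ | t ∈ Ioo (0:ℝ) 1 ∧
    aT p t - (volume ({x | t < p x} \ Ioi (aT p t))).toReal < x}).toReal

/-- `Ω(x) = ∫_{-∞}^x w`. -/
def Om (w : ℝ → ℝ) (x : ℝ) : ℝ := ∫ z in Iic x, w z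

/-- The kernel `V(x) = ∫_{-∞}^x Ω`. -/
def Vker (w : ℝ → ℝ) (x : ℝ) : ℝ := ∫ z in Iic x, Om w z

/-- `κ(x) = V(x) - x Ω(x)`. -/
def kap (w : ℝ → ℝ) (x : ℝ) : ℝ := Vker w x - x * Om w x

/-- Right-continuous generalized inverse of a profile. -/
def rinv (p : ℝ → ℝ) (u : ℝ) : ℝ := sInf {x | u < p x}

/-- Displacement interpolant of two nondecreasing interpolating profiles. -/
def dispInterp (p0 p1 : ℝ → ℝ) (l x : ℝ) : ℝ :=
  sInf {u | u ∈ Ioo (0:ℝ) 1 ∧ x < (1 - l) * rinv p0 u + l * rinv p1 u}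

/-- A profile saturated off of the interval [-K,K]. -/
def Saturated (f : ℝ → ℝ) (K : ℝ) : Prop :=
  (∀ x, x < -K → f x = 0) ∧ (∀ x, K < x → f x = 1)

/-- Consistent fixed point. -/
def IsCFP (w hf hg f g : ℝ → ℝ) : Prop :=
  ∀ x, f x ∈ Icc (Function.leftLim hf (convw g w x)) (Function.rightLim hf (convw g w x)) ∧
       g x ∈ Icc (Function.leftLim hg (convw f w x)) (Function.rightLim hg (convw f w x))

/-- Interval support condition with parameter `W ∈ (0,∞]`. -/
def IntervalSupport (w : ℝ → ℝ) (W : ℝ≥0∞) : Prop :=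
  ∀ x : ℝ, (ENNReal.ofReal |x| < W → 0 < w x) ∧ (W < ENNReal.ofReal |x| → w x = 0)

/-- The functional `L(f,g)`. -/
def Lfun (hf hg f g : ℝ → ℝ) : ℝ :=
  ∫ x, ((∫ v in (0:ℝ)..f x, geninv hf v) - ∫ u in (0:ℝ)..g x, (1 - geninv hg u))

section Order

variable {R : ℝ} {X Y X' Y' : ℝ → ℝ}

/-- If `(a, b)` can only separate the points at distance at least `R` when it is a corner,
then every `X u` has some `Y v` at distance less than `R`. -/
lemma exists_near_of_cut (hX : MonotoneOn X (Ioo 0 1)) (hY : MonotoneOn Y (Ioo 0 1))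
    (hcut : ∀ a ∈ Icc (0:ℝ) 1, ∀ b ∈ Icc (0:ℝ) 1,
      (∀ u ∈ Ioo (0:ℝ) 1, ∀ v ∈ Ioo (0:ℝ) 1, u < a → b < v → X u + R ≤ Y v) →
      (∀ u ∈ Ioo (0:ℝ) 1, ∀ v ∈ Ioo (0:ℝ) 1, a < u → v < b → Y v + R ≤ X u) →
      (a = 0 ∧ b = 0) ∨ (a = 1 ∧ b = 1))
    {u : ℝ} (hu : u ∈ Ioo (0:ℝ) 1) : ∃ v ∈ Ioo (0:ℝ) 1, |X u - Y v| < R := by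
  by_contra! hno
  set S : Set ℝ := {v | v ∈ Ioo (0:ℝ) 1 ∧ Y v + R ≤ X u} with hS
  have hSb : BddAbove S := ⟨1, fun v hv => hv.1.2.le⟩
  have hS0 : 0 ≤ sSup S := Real.sSup_nonneg fun v hv => hv.1.1.le
  have hS1 : sSup S ≤ 1 := Real.sSup_le (fun v hv => hv.1.2.le) zero_le_one
  have h := hcut u ⟨hu.1.le, hu.2.le⟩ (sSup S) ⟨hS0, hS1⟩ ?_ ?_
  · rcases h with h | h
    · exact hu.1.ne' h.1
    · exact hu.2.ne h.1
  · intro u' hu' v hv huu hvS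
    have h1 : X u' ≤ X u := hX hu' hu huu.le
    have h2 : ¬ (Y v + R ≤ X u) := fun h => (le_csSup hSb ⟨hv, h⟩).not_gt hvS
    have h3 := hno v hv
    rcases le_abs.1 h3 with h3 | h3 <;> linarith
  · intro u' hu' v hv huu hvS
    have h1 : X u ≤ X u' := hX hu hu' huu.le
    have hne : S.Nonempty := by
      by_contra hne
      rw [not_nonempty_iff_eq_empty.1 hne, Real.sSup_empty] at hvS
      exact hv.1.not_gt hvS
    obtain ⟨v', hv', hlt⟩ := exists_lt_of_lt_csSup hne hvS
    have h2 := hY hv hv'.1 hlt.le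
    have h3 := hv'.2
    linarith

/-- A displacement that agrees along near pairs is constant above any near pair. -/
lemma displacement_eq_above (hX : MonotoneOn X (Ioo 0 1)) (hY : MonotoneOn Y (Ioo 0 1))
    (hedge : ∀ u ∈ Ioo (0:ℝ) 1, ∀ v ∈ Ioo (0:ℝ) 1, |X u - Y v| < R → X' u - X u = Y' v - Y v)
    (hcut : ∀ a ∈ Icc (0:ℝ) 1, ∀ b ∈ Icc (0:ℝ) 1,
      (∀ u ∈ Ioo (0:ℝ) 1, ∀ v ∈ Ioo (0:ℝ) 1, u < a → b < v → X u + R ≤ Y v) →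
      (∀ u ∈ Ioo (0:ℝ) 1, ∀ v ∈ Ioo (0:ℝ) 1, a < u → v < b → Y v + R ≤ X u) →
      (a = 0 ∧ b = 0) ∨ (a = 1 ∧ b = 1))
    {u₀ v₀ : ℝ} (hu₀ : u₀ ∈ Ioo (0:ℝ) 1) (hv₀ : v₀ ∈ Ioo (0:ℝ) 1) (h₀ : |X u₀ - Y v₀| < R) :
    (∀ u ∈ Ioo (0:ℝ) 1, min (X u₀) (Y v₀) ≤ X u → X' u - X u = X' u₀ - X u₀) ∧
    (∀ v ∈ Ioo (0:ℝ) 1, min (X u₀) (Y v₀) ≤ Y v → Y' v - Y v = X' u₀ - X u₀) := by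
  set c := X' u₀ - X u₀ with hc
  set x₀ := min (X u₀) (Y v₀) with hx₀
  set Q : Set ℝ := {q | x₀ ≤ q ∧ ((∃ u ∈ Ioo (0:ℝ) 1, X u = q ∧ X' u - X u ≠ c) ∨
    (∃ v ∈ Ioo (0:ℝ) 1, Y v = q ∧ Y' v - Y v ≠ c))} with hQ
  suffices hQe : Q = ∅ by
    constructor
    · intro u hu hle
      by_contra hne
      exact (hQe ▸ (⟨hle, Or.inl ⟨u, hu, rfl, hne⟩⟩ : X u ∈ Q) : X u ∈ (∅ : Set ℝ))
    · intro v hv hle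
      by_contra hne
      exact (hQe ▸ (⟨hle, Or.inr ⟨v, hv, rfl, hne⟩⟩ : Y v ∈ Q) : Y v ∈ (∅ : Set ℝ))
  by_contra hQne
  replace hQne : Q.Nonempty := nonempty_iff_ne_empty.2 hQne
  have hcv : Y' v₀ - Y v₀ = c := (hedge u₀ hu₀ v₀ hv₀ h₀).symm
  have hxu : x₀ ≤ X u₀ := min_le_left _ _
  have hxv : x₀ ≤ Y v₀ := min_le_right _ _
  have habs := abs_lt.1 h₀
  have hR : 0 < R := (abs_nonneg _).trans_lt h₀
  have hxu' : X u₀ < x₀ + R := by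
    rw [← sub_lt_iff_lt_add]; exact lt_min (by linarith) (by linarith)
  have hxv' : Y v₀ < x₀ + R := by
    rw [← sub_lt_iff_lt_add]; exact lt_min (by linarith) (by linarith)
  have hQge : ∀ q ∈ Q, x₀ + R ≤ q := by
    rintro q ⟨hq, ⟨u, hu, rfl, hne⟩ | ⟨v, hv, rfl, hne⟩⟩ <;> by_contra! hlt
    · exact hne ((hedge u hu v₀ hv₀ (abs_lt.2 ⟨by linarith, by linarith⟩)).trans hcv)
    · exact hne (hedge u₀ hu₀ v hv (abs_lt.2 ⟨by linarith, by linarith⟩)).symm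
  set p := sInf Q with hp
  have hpge : x₀ + R ≤ p := le_csInf hQne hQge
  have hQb : BddBelow Q := ⟨_, hQge⟩
  set A : Set ℝ := {u | u ∈ Ioo (0:ℝ) 1 ∧ X u < p} with hA
  set B : Set ℝ := {v | v ∈ Ioo (0:ℝ) 1 ∧ Y v < p} with hB
  have hAb : BddAbove A := ⟨1, fun v hv => hv.1.2.le⟩
  have hA0 : 0 ≤ sSup A := Real.sSup_nonneg fun v hv => hv.1.1.le
  have hA1 : sSup A ≤ 1 := Real.sSup_le (fun v hv => hv.1.2.le) zero_le_one
  have hBb : BddAbove B := ⟨1, fun v hv => hv.1.2.le⟩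
  have hB0 : 0 ≤ sSup B := Real.sSup_nonneg fun v hv => hv.1.1.le
  have hB1 : sSup B ≤ 1 := Real.sSup_le (fun v hv => hv.1.2.le) zero_le_one
  have ltA : ∀ u ∈ Ioo (0:ℝ) 1, u < sSup A → X u < p := by
    intro u hu hlt
    have hne : A.Nonempty := by
      by_contra hne
      rw [not_nonempty_iff_eq_empty.1 hne, Real.sSup_empty] at hlt
      exact hu.1.not_gt hlt
    obtain ⟨u', hu', hlt'⟩ := exists_lt_of_lt_csSup hne hlt
    exact (hX hu hu'.1 hlt'.le).trans_lt hu'.2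
  have ltB : ∀ v ∈ Ioo (0:ℝ) 1, v < sSup B → Y v < p := by
    intro u hu hlt
    have hne : B.Nonempty := by
      by_contra hne
      rw [not_nonempty_iff_eq_empty.1 hne, Real.sSup_empty] at hlt
      exact hu.1.not_gt hlt
    obtain ⟨u', hu', hlt'⟩ := exists_lt_of_lt_csSup hne hlt
    exact (hY hu hu'.1 hlt'.le).trans_lt hu'.2
  have geA : ∀ u ∈ Ioo (0:ℝ) 1, sSup A < u → p ≤ X u := fun u hu hlt => by
    by_contra! h
    exact (le_csSup hAb ⟨hu, h⟩).not_gt hlt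
  have geB : ∀ u ∈ Ioo (0:ℝ) 1, sSup B < u → p ≤ Y u := fun u hu hlt => by
    by_contra! h
    exact (le_csSup hBb ⟨hu, h⟩).not_gt hlt
  have goodX : ∀ u ∈ Ioo (0:ℝ) 1, x₀ ≤ X u → X u < p → X' u - X u = c := by
    intro u hu h1 h2
    by_contra hne
    exact (csInf_le hQb ⟨h1, Or.inl ⟨u, hu, rfl, hne⟩⟩).not_gt h2
  have goodY : ∀ v ∈ Ioo (0:ℝ) 1, x₀ ≤ Y v → Y v < p → Y' v - Y v = c := by
    intro u hu h1 h2
    by_contra hne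
    exact (csInf_le hQb ⟨h1, Or.inr ⟨u, hu, rfl, hne⟩⟩).not_gt h2
  have h := hcut (sSup A) ⟨hA0, hA1⟩ (sSup B) ⟨hB0, hB1⟩ ?_ ?_
  · rcases h with ⟨h1, h2⟩ | ⟨h1, h2⟩
    · have hA' : ¬ X u₀ < p := fun h =>
        ((le_csSup hAb ⟨hu₀, h⟩).trans_eq h1).not_gt hu₀.1
      linarith
    · obtain ⟨q, hq⟩ := hQne
      have hpq : p ≤ q := csInf_le hQb hq
      rcases hq with ⟨-, ⟨u, hu, rfl, -⟩ | ⟨v, hv, rfl, -⟩⟩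
      · exact (ltA u hu (h1 ▸ hu.2)).not_ge hpq
      · exact (ltB v hv (h2 ▸ hv.2)).not_ge hpq
  · intro u hu v hv h1 h2
    have h3 := ltA u hu h1
    have h4 := geB v hv h2
    by_contra! h5
    have gu := goodX u hu (by linarith) h3
    have gv := hedge u hu v hv (abs_lt.2 ⟨by linarith, by linarith⟩)
    obtain ⟨q, hq, hlt⟩ := exists_lt_of_csInf_lt hQne (show p < X u + R by linarith)
    have hpq : p ≤ q := csInf_le hQb hq
    rcases hq with ⟨-, ⟨u', hu', rfl, hne⟩ | ⟨v', hv', rfl, hne⟩⟩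
    · have := hedge u' hu' v hv (abs_lt.2 ⟨by linarith, by linarith⟩)
      exact hne (by linarith)
    · have := hedge u hu v' hv' (abs_lt.2 ⟨by linarith, by linarith⟩)
      exact hne (by linarith)
  · intro u hu v hv h1 h2
    have h3 := ltB v hv h2
    have h4 := geA u hu h1
    by_contra! h5
    have gu := goodY v hv (by linarith) h3
    have gv := hedge u hu v hv (abs_lt.2 ⟨by linarith, by linarith⟩)
    obtain ⟨q, hq, hlt⟩ := exists_lt_of_csInf_lt hQne (show p < Y v + R by linarith)
    have hpq : p ≤ q := csInf_le hQb hq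
    rcases hq with ⟨-, ⟨u', hu', rfl, hne⟩ | ⟨v', hv', rfl, hne⟩⟩
    · have := hedge u' hu' v hv (abs_lt.2 ⟨by linarith, by linarith⟩)
      exact hne (by linarith)
    · have := hedge u hu v' hv' (abs_lt.2 ⟨by linarith, by linarith⟩)
      exact hne (by linarith)

/-- A displacement that agrees along near pairs is constant when no proper cut exists. -/
lemma displacement_eq (hX : MonotoneOn X (Ioo 0 1)) (hY : MonotoneOn Y (Ioo 0 1))
    (hedge : ∀ u ∈ Ioo (0:ℝ) 1, ∀ v ∈ Ioo (0:ℝ) 1, |X u - Y v| < R → X' u - X u = Y' v - Y v)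
    (hcut : ∀ a ∈ Icc (0:ℝ) 1, ∀ b ∈ Icc (0:ℝ) 1,
      (∀ u ∈ Ioo (0:ℝ) 1, ∀ v ∈ Ioo (0:ℝ) 1, u < a → b < v → X u + R ≤ Y v) →
      (∀ u ∈ Ioo (0:ℝ) 1, ∀ v ∈ Ioo (0:ℝ) 1, a < u → v < b → Y v + R ≤ X u) →
      (a = 0 ∧ b = 0) ∨ (a = 1 ∧ b = 1))
    {u v : ℝ} (hu : u ∈ Ioo (0:ℝ) 1) (hv : v ∈ Ioo (0:ℝ) 1) :
    X' u - X u = Y' v - Y v := by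
  obtain ⟨v', hv', h1⟩ := exists_near_of_cut hX hY hcut hu
  obtain ⟨u', hu', h2⟩ := exists_near_of_cut hY hX
    (fun a ha b hb h h' => (hcut b hb a ha (fun u hu v hv hub hav => h' v hv u hu hav hub)
      (fun u hu v hv hub hav => h v hv u hu hav hub)).imp And.symm And.symm) hv
  rcases le_total (X u) (Y v) with h | h
  · exact ((displacement_eq_above hX hY hedge hcut hu hv' h1).2 v hv
      ((min_le_left _ _).trans h)).symm
  · rw [abs_sub_comm] at h2
    rw [(displacement_eq_above hX hY hedge hcut hu' hv h2).1 u hu ((min_le_right _ _).trans h)]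
    exact hedge u' hu' v hv h2

end Order

section Quantile

variable {f f' : ℝ → ℝ}

lemma bddBelow_superlevel (hf : IsProfile f) (hm : Monotone f) {u : ℝ} (hu : 0 < u) :
    BddBelow {x | u < f x} := by
  obtain ⟨x, hx⟩ := (hf.2.1.eventually_lt_const hu).exists
  refine ⟨x, fun y hy => ?_⟩
  by_contra! h
  exact (hm h.le).not_gt (hx.trans hy)

lemma nonempty_superlevel (hf : IsProfile f) {u : ℝ} (hu : u < 1) :
    {x | u < f x}.Nonempty := (hf.2.2.eventually_const_lt hu).exists

lemma le_of_lt_rinv (hf : IsProfile f) (hm : Monotone f) {u x : ℝ} (hu : 0 < u)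
    (hx : x < rinv f u) : f x ≤ u := by
  by_contra! h
  exact (csInf_le (bddBelow_superlevel hf hm hu) h).not_gt hx

lemma lt_of_rinv_lt (hf : IsProfile f) (hm : Monotone f) {u x : ℝ} (hu : u < 1)
    (hx : rinv f u < x) : u < f x := by
  obtain ⟨y, hy, hlt⟩ := exists_lt_of_csInf_lt (nonempty_superlevel hf hu) hx
  exact lt_of_lt_of_le hy (hm hlt.le)

lemma rinv_le_of_lt (hf : IsProfile f) (hm : Monotone f) {u x : ℝ} (hu : 0 < u)
    (hx : u < f x) : rinv f u ≤ x := csInf_le (bddBelow_superlevel hf hm hu) hx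

lemma monotoneOn_rinv (hf : IsProfile f) (hm : Monotone f) :
    MonotoneOn (rinv f) (Ioo 0 1) := fun _ hu _ hv huv =>
  csInf_le_csInf (bddBelow_superlevel hf hm hu.1) (nonempty_superlevel hf hv.2)
    fun _ hx => lt_of_le_of_lt huv hx

lemma continuousWithinAt_rinv (hf : IsProfile f) (hm : Monotone f) {u : ℝ}
    (hu : u ∈ Ioo (0:ℝ) 1) : ContinuousWithinAt (rinv f) (Ioi u) u := by
  refine tendsto_order.2 ⟨fun a ha => ?_, fun a ha => ?_⟩
  · filter_upwards [Ioo_mem_nhdsGT hu.2] with v hv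
    exact ha.trans_le (monotoneOn_rinv hf hm hu ⟨hu.1.trans hv.1, hv.2⟩ hv.1.le)
  · obtain ⟨b, hb, hba⟩ := exists_between ha
    filter_upwards [Ioo_mem_nhdsGT (lt_of_rinv_lt hf hm hu.2 hb)] with v hv
    exact (rinv_le_of_lt hf hm (hu.1.trans hv.1) hv.2).trans_lt hba

lemma ae_le_of_rinv_eq_add (hf : IsProfile f) (hm : Monotone f) (hf' : IsProfile f')
    (hm' : Monotone f') {c : ℝ} (h : ∀ u ∈ Ioo (0:ℝ) 1, rinv f u + c ≤ rinv f' u) :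
    ∀ᵐ x, f' x ≤ f (x - c) := by
  have hcount : {x | ¬ ContinuousAt (fun x => f (x - c)) x}.Countable :=
    Monotone.countable_not_continuousAt fun x y hxy => hm (by linarith)
  filter_upwards [compl_mem_ae_iff.2 (hcount.measure_zero volume)] with x hx
  replace hx : ContinuousAt (fun x => f (x - c)) x := by simpa using hx
  by_contra! hlt
  obtain ⟨u, hu1, hu2⟩ := exists_between hlt
  have hu : u ∈ Ioo (0:ℝ) 1 := ⟨(hf.1 _).1.trans_lt hu1, hu2.trans_le (hf'.1 _).2⟩
  have hr := rinv_le_of_lt hf' hm' hu.1 hu2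
  have hev : ∀ᶠ y in nhdsWithin x (Ioi x), f (y - c) < u :=
    (hx.eventually_lt_const hu1).filter_mono nhdsWithin_le_nhds
  obtain ⟨y, hy, hxy⟩ := (hev.and self_mem_nhdsWithin).exists
  have hxy' : x < y := hxy
  have := lt_of_rinv_lt hf hm hu.2 (x := y - c) (by linarith [h u hu])
  linarith

/-- Profiles whose quantile functions differ by a constant are translates of each other. -/
lemma ae_eq_translate_of_rinv_eq_add (hf : IsProfile f) (hm : Monotone f) (hf' : IsProfile f')
    (hm' : Monotone f') {c : ℝ} (h : ∀ u ∈ Ioo (0:ℝ) 1, rinv f' u - rinv f u = c) :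
    ∀ᵐ x, f' x = f (x - c) := by
  have h1 := ae_le_of_rinv_eq_add hf hm hf' hm' (c := c) fun u hu => by linarith [h u hu]
  have h2 := ae_le_of_rinv_eq_add hf' hm' hf hm (c := -c) fun u hu => by linarith [h u hu]
  have h3 : ∀ᵐ x, f (x - c) ≤ f' (x - c - -c) :=
    (measurePreserving_sub_right volume c).quasiMeasurePreserving.ae h2
  filter_upwards [h1, h3] with x h1 h3
  rw [sub_neg_eq_add, sub_add_cancel] at h3
  exact le_antisymm h1 h3

end Quantile

section Kernel

variable {w : ℝ → ℝ}

lemma Om_sub_Om (hw : IsWindow w) (x y : ℝ) : Om w y - Om w x = ∫ z in x..y, w z :=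
  intervalIntegral.integral_Iic_sub_Iic hw.integrable.integrableOn hw.integrable.integrableOn

lemma monotone_Om (hw : IsWindow w) : Monotone (Om w) := fun x y hxy => by
  rw [← sub_nonneg, Om_sub_Om hw]
  exact intervalIntegral.integral_nonneg hxy fun z _ => hw.nonneg z

lemma continuous_Om (hw : IsWindow w) : Continuous (Om w) := by
  have h : Om w = fun x => Om w 0 + ∫ z in (0:ℝ)..x, w z := by
    ext x; rw [← Om_sub_Om hw]; ring
  rw [h]
  exact continuous_const.add
    (intervalIntegral.continuous_primitive (fun _ _ => hw.integrable.intervalIntegrable) 0)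

lemma Om_neg (hw : IsWindow w) (x : ℝ) : Om w (-x) = 1 - Om w x := by
  have h1 : Om w (-x) = ∫ z in Ioi x, w z := by
    rw [Om, ← neg_neg x, ← integral_comp_neg_Iic (-x) w, neg_neg]
    simp_rw [hw.even]
  have h2 : (∫ z in Iic x, w z) + ∫ z in Ioi x, w z = ∫ z, w z := by
    rw [← compl_Iic]; exact integral_add_compl measurableSet_Iic hw.integrable
  rw [h1, ← hw.normalized, ← h2, Om]; ring

lemma Om_nonneg (hw : IsWindow w) (x : ℝ) : 0 ≤ Om w x :=
  integral_nonneg fun z => hw.nonneg z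

lemma Om_le_one (hw : IsWindow w) (x : ℝ) : Om w x ≤ 1 := by
  have := Om_nonneg hw (-x)
  rw [Om_neg hw] at this; linarith

lemma norm_Om_le (hw : IsWindow w) (x : ℝ) : ‖Om w x‖ ≤ 1 := by
  rw [Real.norm_of_nonneg (Om_nonneg hw x)]; exact Om_le_one hw x

lemma Om_eq_zero {R : ℝ} (h : ∀ x, R < |x| → w x = 0) {x : ℝ} (hx : x ≤ -R) : Om w x = 0 := by
  rw [Om, integral_Iic_eq_integral_Iio]
  refine setIntegral_eq_zero_of_forall_eq_zero fun z hz => h z ?_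
  have hz' : z < x := hz
  exact lt_of_lt_of_le (by linarith) (neg_le_abs z)

lemma Om_lt_Om (hw : IsWindow w) {W : ℝ≥0∞} (hsup : IntervalSupport w W) {x y : ℝ}
    (hx : ENNReal.ofReal |x| < W) (hxy : x < y) : Om w x < Om w y := by
  have hev : ∀ᶠ z in nhds x, 0 < w z := by
    have hc : Continuous fun z : ℝ => ENNReal.ofReal |z| :=
      ENNReal.continuous_ofReal.comp continuous_abs
    exact (hc.continuousAt.eventually_lt continuousAt_const hx).mono fun z hz => (hsup z).1 hz
  obtain ⟨e, he, hball⟩ := Metric.eventually_nhds_iff.1 hev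
  obtain ⟨y', hy', hlt⟩ := exists_between (lt_min hxy (show x < x + e by linarith))
  have h1 : 0 < ∫ z in x..y', w z := by
    refine intervalIntegral.intervalIntegral_pos_of_pos_on hw.integrable.intervalIntegrable
      (fun z hz => hball ?_) hy'
    rw [Real.dist_eq, abs_of_pos (by linarith [hz.1])]
    linarith [hz.2, lt_min_iff.1 hlt]
  rw [← Om_sub_Om hw] at h1
  linarith [monotone_Om hw (hlt.le.trans (min_le_left _ _))]

lemma eq_of_Om_eq (hw : IsWindow w) {W : ℝ≥0∞} (hsup : IntervalSupport w W) {x y : ℝ}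
    (hx : ENNReal.ofReal |x| < W) (h : Om w x = Om w y) : x = y := by
  rcases lt_trichotomy x y with hlt | heq | hlt
  · exact absurd h (Om_lt_Om hw hsup hx hlt).ne
  · exact heq
  · have := Om_lt_Om hw hsup (x := -x) (y := -y) (by rwa [abs_neg]) (by linarith)
    rw [Om_neg hw, Om_neg hw] at this
    linarith

/-- Lebesgue measure on the unit interval. -/
def unitMeasure : Measure ℝ := volume.restrict (Ioo 0 1)

instance : IsProbabilityMeasure unitMeasure := ⟨by simp [unitMeasure]⟩

lemma ae_unitMeasure_mem : ∀ᵐ u ∂unitMeasure, u ∈ Ioo (0:ℝ) 1 :=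
  ae_restrict_mem measurableSet_Ioo

/-- Convolution of a profile with the window, expressed by its quantile function. -/
lemma convw_eq (hw : IsWindow w) {g : ℝ → ℝ} (hg : IsProfile g) (hm : Monotone g) (x : ℝ) :
    convw g w x = ∫ v, Om w (x - rinv g v) ∂unitMeasure := by
  have hInt : Integrable (fun p : ℝ × ℝ => ({p : ℝ × ℝ | p.2 < g p.1}.indicator
      (fun p => w (x - p.1))) p) (volume.prod unitMeasure) := by
    refine Integrable.indicator ((hw.integrable.comp_sub_left x).comp_fst unitMeasure) ?_
    exact measurableSet_lt measurable_snd (hm.measurable.comp measurable_fst)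
  have h1 : ∀ y, g y * w (x - y) = ∫ v, ({p : ℝ × ℝ | p.2 < g p.1}.indicator
      (fun p => w (x - p.1))) (y, v) ∂unitMeasure := by
    intro y
    have : (fun v => ({p : ℝ × ℝ | p.2 < g p.1}.indicator (fun p => w (x - p.1))) (y, v))
        = (Iio (g y)).indicator fun _ => w (x - y) := by
      ext v; simp [indicator]
    rw [this, integral_indicator measurableSet_Iio, setIntegral_const, smul_eq_mul]
    congr 1
    rw [unitMeasure, measureReal_restrict_apply measurableSet_Iio]
    have hs : Iio (g y) ∩ Ioo 0 1 = Ioo 0 (g y) := by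
      ext v
      simp only [mem_inter_iff, mem_Iio, mem_Ioo]
      exact ⟨fun h => ⟨h.2.1, h.1⟩, fun h => ⟨h.2, h.1, h.2.trans_le (hg.1 y).2⟩⟩
    rw [hs, Real.volume_real_Ioo_of_le (hg.1 y).1, sub_zero]
  simp_rw [convw, h1]
  rw [integral_integral_swap hInt]
  refine integral_congr_ae ?_
  filter_upwards [ae_unitMeasure_mem] with v hv
  have h2 : Om w (x - rinv g v) = ∫ y, (Iic (x - rinv g v)).indicator w (x - y) := by
    rw [integral_sub_left_eq_self (fun y => (Iic (x - rinv g v)).indicator w y),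
      integral_indicator measurableSet_Iic, Om]
  rw [h2]
  refine integral_congr_ae ?_
  filter_upwards [compl_mem_ae_iff.2 (measure_singleton (μ := volume) (rinv g v))] with y hy
  rcases lt_or_gt_of_ne (show y ≠ rinv g v from hy) with h | h
  · have h' : ¬ v < g y := (le_of_lt_rinv hg hm hv.1 h).not_gt
    have h'' : ¬ x - y ≤ x - rinv g v := by linarith
    simp only [indicator, mem_ofPred_eq, h', mem_Iic, h'', if_false]
  · have h' : v < g y := lt_of_rinv_lt hg hm hv.2 h
    have h'' : x - y ≤ x - rinv g v := by linarith
    simp only [indicator, mem_ofPred_eq, h', mem_Iic, h'', if_true]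

lemma aestronglyMeasurable_rinv {g : ℝ → ℝ} (hg : IsProfile g) (hm : Monotone g) :
    AEStronglyMeasurable (rinv g) unitMeasure :=
  (aemeasurable_restrict_of_monotoneOn measurableSet_Ioo
    (monotoneOn_rinv hg hm)).aestronglyMeasurable

lemma continuous_convw (hw : IsWindow w) {g : ℝ → ℝ} (hg : IsProfile g) (hm : Monotone g) :
    Continuous (convw g w) := by
  rw [funext (convw_eq hw hg hm)]
  refine continuous_of_dominated (bound := fun _ => 1) (fun x => ?_)
    (fun x => .of_forall fun v => norm_Om_le hw _) (integrable_const _) (.of_forall fun v => ?_)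
  · exact (continuous_Om hw).comp_aestronglyMeasurable
      (aestronglyMeasurable_const.sub (aestronglyMeasurable_rinv hg hm))
  · exact (continuous_Om hw).comp (continuous_id.sub continuous_const)

lemma integrable_Om_comp (hw : IsWindow w) {α : Type*} [MeasurableSpace α] {μ : Measure α}
    [IsFiniteMeasure μ] {F : α → ℝ} (hF : AEStronglyMeasurable F μ) :
    Integrable (fun a => Om w (F a)) μ :=
  Integrable.of_bound ((continuous_Om hw).comp_aestronglyMeasurable hF) 1
    (.of_forall fun _ => norm_Om_le hw _)

lemma convw_mem_Icc (hw : IsWindow w) {g : ℝ → ℝ} (hg : IsProfile g) (hm : Monotone g)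
    (x : ℝ) : convw g w x ∈ Icc (0:ℝ) 1 := by
  rw [convw_eq hw hg hm]
  refine ⟨integral_nonneg fun v => Om_nonneg hw _, ?_⟩
  calc _ ≤ ∫ v, (1:ℝ) ∂unitMeasure := integral_mono
        (integrable_Om_comp hw (aestronglyMeasurable_const.sub (aestronglyMeasurable_rinv hg hm)))
        (integrable_const _) fun v => Om_le_one hw _
    _ = 1 := by simp

end Kernel

section FixedPoint

variable {h : ℝ → ℝ}

lemma IsUpdate.monotone_extend (hh : IsUpdate h) :
    Monotone fun x => h (projIcc (0:ℝ) 1 zero_le_one x) := fun x y hxy =>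
  hh.1 (projIcc (0:ℝ) 1 zero_le_one x).2 (projIcc (0:ℝ) 1 zero_le_one y).2 (monotone_projIcc _ hxy)

lemma IsUpdate.le_leftLim (hh : IsUpdate h) {v a : ℝ} (hv : 0 ≤ v) (hva : v < a) (ha : a ≤ 1) :
    h v ≤ Function.leftLim h a := by
  have hm := hh.monotone_extend
  have ht : Tendsto h (nhdsWithin a (Iio a))
      (nhds (Function.leftLim (fun x => h (projIcc (0:ℝ) 1 zero_le_one x)) a)) := by
    refine (hm.tendsto_leftLim a).congr' ?_
    filter_upwards [Ioo_mem_nhdsLT (hv.trans_lt hva)] with z hz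
    rw [projIcc_of_mem zero_le_one (⟨hz.1.le, hz.2.le.trans ha⟩ : z ∈ Icc (0:ℝ) 1)]
  rw [leftLim_eq_of_tendsto ht]
  refine le_trans (le_of_eq ?_) (hm.le_leftLim hva)
  rw [projIcc_of_mem zero_le_one (⟨hv, hva.le.trans ha⟩ : v ∈ Icc (0:ℝ) 1)]

lemma IsUpdate.rightLim_le (hh : IsUpdate h) {v a : ℝ} (ha : 0 ≤ a) (hva : a < v) (hv : v ≤ 1) :
    Function.rightLim h a ≤ h v := by
  have hm := hh.monotone_extend
  have ht : Tendsto h (nhdsWithin a (Ioi a))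
      (nhds (Function.rightLim (fun x => h (projIcc (0:ℝ) 1 zero_le_one x)) a)) := by
    refine (hm.tendsto_rightLim a).congr' ?_
    filter_upwards [Ioo_mem_nhdsGT (hva.trans_le hv)] with z hz
    rw [projIcc_of_mem zero_le_one (⟨ha.trans hz.1.le, hz.2.le⟩ : z ∈ Icc (0:ℝ) 1)]
  rw [rightLim_eq_of_tendsto ht]
  refine (hm.rightLim_le hva).trans (le_of_eq ?_)
  rw [projIcc_of_mem zero_le_one (⟨ha.trans hva.le, hv⟩ : v ∈ Icc (0:ℝ) 1)]

lemma IsUpdate.geninv_le (hh : IsUpdate h) {u v a : ℝ} (ha : a ∈ Icc (0:ℝ) 1) (hu : u < 1)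
    (hv : u < v) (hva : v ≤ Function.rightLim h a) : geninv h u ≤ a := by
  have hb : BddBelow {v | v ∈ Icc (0:ℝ) 1 ∧ u < h v} := ⟨0, fun v hv => hv.1.1⟩
  rcases ha.2.eq_or_lt with rfl | ha1
  · exact csInf_le hb ⟨⟨zero_le_one, le_rfl⟩, by rwa [hh.2.2.2]⟩
  · refine le_of_forall_gt_imp_ge_of_dense fun b hb' => ?_
    obtain ⟨z, hz, hz'⟩ := exists_between (lt_min hb' ha1)
    have hz1 : z ≤ 1 := hz'.le.trans (min_le_right _ _)
    refine (csInf_le hb ⟨⟨ha.1.trans hz.le, hz1⟩, ?_⟩).trans (hz'.le.trans (min_le_left _ _))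
    exact hv.trans_le (hva.trans (hh.rightLim_le ha.1 hz hz1))

lemma IsUpdate.le_geninv (hh : IsUpdate h) {u v a : ℝ} (ha : a ∈ Icc (0:ℝ) 1) (hu : u < 1)
    (hv : v ≤ u) (hva : Function.leftLim h a ≤ v) : a ≤ geninv h u := by
  refine le_csInf ⟨1, ⟨zero_le_one, le_rfl⟩, by rwa [hh.2.2.2]⟩ fun z hz => ?_
  by_contra! hlt
  exact ((hh.le_leftLim hz.1.1 hlt ha.2).trans (hva.trans hv)).not_gt hz.2

/-- Along a profile solving the fixed point inclusion, the input at the quantile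
position equals the generalized inverse of the update function. -/
lemma eq_geninv_of_mem (hh : IsUpdate h) {f G : ℝ → ℝ} (hf : IsProfile f) (hm : Monotone f)
    (hG : Continuous G) (hG1 : ∀ x, G x ∈ Icc (0:ℝ) 1)
    (hfix : ∀ x, f x ∈ Icc (Function.leftLim h (G x)) (Function.rightLim h (G x)))
    {u : ℝ} (hu : u ∈ Ioo (0:ℝ) 1) : G (rinv f u) = geninv h u := by
  apply le_antisymm
  · refine le_of_tendsto (hG.continuousAt.continuousWithinAt (s := Iio (rinv f u))) ?_
    filter_upwards [self_mem_nhdsWithin] with x hx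
    exact hh.le_geninv (hG1 x) hu.2 (le_of_lt_rinv hf hm hu.1 hx) (hfix x).1
  · refine ge_of_tendsto (hG.continuousAt.continuousWithinAt (s := Ioi (rinv f u))) ?_
    filter_upwards [self_mem_nhdsWithin] with x hx
    exact hh.geninv_le (hG1 x) hu.2 (lt_of_rinv_lt hf hm hu.2 hx) (hfix x).2

variable {w hf hg f g : ℝ → ℝ}

lemma IsCFP.swap (hc : IsCFP w hf hg f g) : IsCFP w hg hf g f := fun x => (hc x).symm

lemma IsCFP.integral_Om (hc : IsCFP w hf hg f g) (hw : IsWindow w) (hhf : IsUpdate hf)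
    (hpf : IsProfile f) (hpg : IsProfile g) (hfm : Monotone f) (hgm : Monotone g)
    {u : ℝ} (hu : u ∈ Ioo (0:ℝ) 1) :
    ∫ v, Om w (rinv f u - rinv g v) ∂unitMeasure = geninv hf u := by
  rw [← convw_eq hw hpg hgm]
  exact eq_geninv_of_mem hhf hpf hfm (continuous_convw hw hpg hgm) (convw_mem_Icc hw hpg hgm)
    (fun x => (hc x).1) hu

end FixedPoint

section Rigidity

variable {w X Y X' Y' : ℝ → ℝ}

lemma eq_zero_of_ae_of_rightContinuous {φ : ℝ → ℝ} (h : ∀ᵐ u ∂unitMeasure, φ u = 0) {t : ℝ}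
    (ht : t ∈ Ioo (0:ℝ) 1) (hc : ContinuousWithinAt φ (Ioi t) t) : φ t = 0 := by
  by_contra hne
  obtain ⟨b, hb, hsub⟩ := (mem_nhdsGT_iff_exists_Ioo_subset' ht.2).1 (hc.eventually_ne hne)
  have htb : t < min b 1 := lt_min hb ht.2
  have h' := (ae_restrict_iff' measurableSet_Ioo).1 h
  have hzero : volume (Ioo t (min b 1)) = 0 := by
    refine measure_mono_null (fun u hu => ?_) (ae_iff.1 h')
    exact fun hcon => hsub ⟨hu.1, hu.2.trans_le (min_le_left _ _)⟩
      (hcon ⟨ht.1.trans hu.1, hu.2.trans_le (min_le_right _ _)⟩)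
  rw [Real.volume_Ioo, ENNReal.ofReal_eq_zero] at hzero
  linarith

lemma integrable_Om_const_sub (hw : IsWindow w) {μ : Measure ℝ} [IsFiniteMeasure μ]
    (mX : AEStronglyMeasurable X μ) (x : ℝ) : Integrable (fun u => Om w (x - X u)) μ :=
  integrable_Om_comp hw (aestronglyMeasurable_const.sub mX)

lemma ae_prod_Om_eq (hw : IsWindow w)
    (mX : AEStronglyMeasurable X unitMeasure) (mY : AEStronglyMeasurable Y unitMeasure)
    (mX' : AEStronglyMeasurable X' unitMeasure) (mY' : AEStronglyMeasurable Y' unitMeasure)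
    (h1 : ∀ u ∈ Ioo (0:ℝ) 1, ∫ v, Om w (X' u - Y' v) ∂unitMeasure
      = ∫ v, Om w (X u - Y v) ∂unitMeasure)
    (h2 : ∀ v ∈ Ioo (0:ℝ) 1, ∫ u, Om w (Y' v - X' u) ∂unitMeasure
      = ∫ u, Om w (Y v - X u) ∂unitMeasure) :
    ∀ᵐ p ∂(unitMeasure.prod unitMeasure),
      Om w (X' p.1 - Y' p.2) - Om w (X p.1 - Y p.2) = 0 := by
  set K : ℝ × ℝ → ℝ := fun p => Om w (X' p.1 - Y' p.2) - Om w (X p.1 - Y p.2) with hK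
  set A : ℝ → ℝ := fun u => Real.arctan (X' u - X u) with hA
  set B : ℝ → ℝ := fun v => Real.arctan (Y' v - Y v) with hB
  have iK : Integrable K (unitMeasure.prod unitMeasure) :=
    (integrable_Om_comp hw (mX'.comp_fst.sub mY'.comp_snd)).sub
      (integrable_Om_comp hw (mX.comp_fst.sub mY.comp_snd))
  have hbd : ∀ x, ‖Real.arctan x‖ ≤ Real.pi / 2 := fun x => by
    rw [Real.norm_eq_abs, abs_le]
    exact ⟨(Real.neg_pi_div_two_lt_arctan x).le, (Real.arctan_lt_pi_div_two x).le⟩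
  have mA : AEStronglyMeasurable A unitMeasure :=
    Real.continuous_arctan.comp_aestronglyMeasurable (mX'.sub mX)
  have mB : AEStronglyMeasurable B unitMeasure :=
    Real.continuous_arctan.comp_aestronglyMeasurable (mY'.sub mY)
  have iA : Integrable (fun p : ℝ × ℝ => A p.1 * K p) (unitMeasure.prod unitMeasure) :=
    iK.bdd_mul mA.comp_fst (.of_forall fun p => hbd _)
  have iB : Integrable (fun p : ℝ × ℝ => B p.2 * K p) (unitMeasure.prod unitMeasure) :=
    iK.bdd_mul mB.comp_snd (.of_forall fun p => hbd _)
  have zA : ∫ p, A p.1 * K p ∂(unitMeasure.prod unitMeasure) = 0 := by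
    rw [integral_prod _ iA]
    refine integral_eq_zero_of_ae ?_
    filter_upwards [ae_unitMeasure_mem] with u hu
    simp only [hK, Pi.zero_apply]
    rw [integral_const_mul, integral_sub
      (integrable_Om_const_sub hw mY' _)
      (integrable_Om_const_sub hw mY _), h1 u hu, sub_self, mul_zero]
  have zB : ∫ p, B p.2 * K p ∂(unitMeasure.prod unitMeasure) = 0 := by
    rw [integral_prod_symm _ iB]
    refine integral_eq_zero_of_ae ?_
    filter_upwards [ae_unitMeasure_mem] with v hv
    have hneg : ∀ u, Om w (X' u - Y' v) - Om w (X u - Y v)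
        = Om w (Y v - X u) - Om w (Y' v - X' u) := fun u => by
      rw [← neg_sub (X' u), ← neg_sub (X u), Om_neg hw, Om_neg hw]; ring
    simp only [hK, hneg, Pi.zero_apply]
    rw [integral_const_mul, integral_sub
      (integrable_Om_const_sub hw mX _)
      (integrable_Om_const_sub hw mX' _), h2 v hv, sub_self, mul_zero]
  have hzero : ∫ p, (A p.1 * K p - B p.2 * K p) ∂(unitMeasure.prod unitMeasure) = 0 := by
    rw [integral_sub iA iB, zA, zB, sub_zero]
  have hnn : 0 ≤ fun p => A p.1 * K p - B p.2 * K p := fun p => by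
    simp only [Pi.zero_apply, ← sub_mul]
    rcases le_total (X' p.1 - X p.1) (Y' p.2 - Y p.2) with h | h
    · exact mul_nonneg_of_nonpos_of_nonpos
        (sub_nonpos.2 (Real.arctan_strictMono.monotone h))
        (sub_nonpos.2 (monotone_Om hw (by linarith)))
    · exact mul_nonneg (sub_nonneg.2 (Real.arctan_strictMono.monotone h))
        (sub_nonneg.2 (monotone_Om hw (by linarith)))
  filter_upwards [(integral_eq_zero_iff_of_nonneg hnn (iA.sub iB)).1 hzero] with p hp
  simp only [Pi.zero_apply, ← sub_mul] at hp
  rcases mul_eq_zero.1 hp with h | h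
  · have := Real.arctan_injective (sub_eq_zero.1 h)
    rw [sub_eq_zero]
    congr 1
    linarith
  · exact h

/-- Two solutions of the quantile equations have the same interaction kernel. -/
lemma Om_eq_of_integral_eq (hw : IsWindow w)
    (mX : AEStronglyMeasurable X unitMeasure) (mY : AEStronglyMeasurable Y unitMeasure)
    (mX' : AEStronglyMeasurable X' unitMeasure) (mY' : AEStronglyMeasurable Y' unitMeasure)
    (cX : ∀ u ∈ Ioo (0:ℝ) 1, ContinuousWithinAt X (Ioi u) u)
    (cY : ∀ u ∈ Ioo (0:ℝ) 1, ContinuousWithinAt Y (Ioi u) u)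
    (cX' : ∀ u ∈ Ioo (0:ℝ) 1, ContinuousWithinAt X' (Ioi u) u)
    (cY' : ∀ u ∈ Ioo (0:ℝ) 1, ContinuousWithinAt Y' (Ioi u) u)
    (h1 : ∀ u ∈ Ioo (0:ℝ) 1, ∫ v, Om w (X' u - Y' v) ∂unitMeasure
      = ∫ v, Om w (X u - Y v) ∂unitMeasure)
    (h2 : ∀ v ∈ Ioo (0:ℝ) 1, ∫ u, Om w (Y' v - X' u) ∂unitMeasure
      = ∫ u, Om w (Y v - X u) ∂unitMeasure)
    {u v : ℝ} (hu : u ∈ Ioo (0:ℝ) 1) (hv : v ∈ Ioo (0:ℝ) 1) :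
    Om w (X u - Y v) = Om w (X' u - Y' v) := by
  have hae := Measure.ae_ae_of_ae_prod (ae_prod_Om_eq hw mX mY mX' mY' h1 h2)
  have hO := continuous_Om hw
  have hae' : ∀ᵐ u ∂unitMeasure, Om w (X' u - Y' v) - Om w (X u - Y v) = 0 := by
    filter_upwards [hae] with u hu
    refine eq_zero_of_ae_of_rightContinuous hu hv ?_
    exact (hO.continuousAt.comp_continuousWithinAt
      (continuousWithinAt_const.sub (cY' v hv))).sub
      (hO.continuousAt.comp_continuousWithinAt (continuousWithinAt_const.sub (cY v hv)))
  refine (sub_eq_zero.1 (eq_zero_of_ae_of_rightContinuous hae' hu ?_)).symm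
  exact (hO.continuousAt.comp_continuousWithinAt
    ((cX' u hu).sub continuousWithinAt_const)).sub
    (hO.continuousAt.comp_continuousWithinAt ((cX u hu).sub continuousWithinAt_const))

/-- The primitive of a generalized inverse solving the quantile equation, at a level where
the far points do not interact. -/
lemma integral_geninv_eq {h : ℝ → ℝ}
    (heq : ∀ u ∈ Ioo (0:ℝ) 1, ∫ v, Om w (X u - Y v) ∂unitMeasure = geninv h u)
    {a b : ℝ} (ha : a ∈ Icc (0:ℝ) 1) (hb : b ∈ Icc (0:ℝ) 1)
    (hfar : ∀ u ∈ Ioo (0:ℝ) 1, ∀ v ∈ Ioo (0:ℝ) 1, u < a → b < v → Om w (X u - Y v) = 0) :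
    ∫ u in (0:ℝ)..a, geninv h u = ∫ u in Ioo 0 a, ∫ v in Ioo 0 b, Om w (X u - Y v) := by
  rw [intervalIntegral.integral_of_le ha.1, integral_Ioc_eq_integral_Ioo]
  refine setIntegral_congr_fun measurableSet_Ioo fun u hu => ?_
  have hu' : u ∈ Ioo (0:ℝ) 1 := ⟨hu.1, hu.2.trans_le ha.2⟩
  rw [← heq u hu', unitMeasure]
  refine (setIntegral_eq_of_subset_of_ae_sdiff_eq_zero measurableSet_Ioo.nullMeasurableSet
    (Ioo_subset_Ioo_right hb.2) ?_)
  filter_upwards [compl_mem_ae_iff.2 (measure_singleton (μ := volume) b)] with v hvb hv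
  refine hfar u hu' v hv.1 hu.2 (lt_of_le_of_ne ?_ (Ne.symm hvb))
  by_contra! hlt
  exact hv.2 ⟨hv.1.1, hlt⟩

/-- The potential vanishes at a level separating the quantiles into non-interacting parts. -/
lemma pot_eq_zero_of_cut (hw : IsWindow w) {hf hg : ℝ → ℝ}
    (mX : AEStronglyMeasurable X unitMeasure) (mY : AEStronglyMeasurable Y unitMeasure)
    (h1 : ∀ u ∈ Ioo (0:ℝ) 1, ∫ v, Om w (X u - Y v) ∂unitMeasure = geninv hf u)
    (h2 : ∀ v ∈ Ioo (0:ℝ) 1, ∫ u, Om w (Y v - X u) ∂unitMeasure = geninv hg v)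
    {a b : ℝ} (ha : a ∈ Icc (0:ℝ) 1) (hb : b ∈ Icc (0:ℝ) 1)
    (hab : ∀ u ∈ Ioo (0:ℝ) 1, ∀ v ∈ Ioo (0:ℝ) 1, u < a → b < v → Om w (X u - Y v) = 0)
    (hba : ∀ v ∈ Ioo (0:ℝ) 1, ∀ u ∈ Ioo (0:ℝ) 1, v < b → a < u → Om w (Y v - X u) = 0) :
    pot hf hg b a = 0 := by
  have mX' : AEStronglyMeasurable X (volume.restrict (Ioo 0 a)) :=
    mX.mono_measure (Measure.restrict_mono_set _ (Ioo_subset_Ioo_right ha.2))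
  have mY' : AEStronglyMeasurable Y (volume.restrict (Ioo 0 b)) :=
    mY.mono_measure (Measure.restrict_mono_set _ (Ioo_subset_Ioo_right hb.2))
  have iXY : Integrable (fun p : ℝ × ℝ => Om w (X p.1 - Y p.2))
      ((volume.restrict (Ioo 0 a)).prod (volume.restrict (Ioo 0 b))) :=
    integrable_Om_comp hw (mX'.comp_fst.sub mY'.comp_snd)
  have iYX : Integrable (fun p : ℝ × ℝ => Om w (Y p.2 - X p.1))
      ((volume.restrict (Ioo 0 a)).prod (volume.restrict (Ioo 0 b))) :=
    integrable_Om_comp hw (mY'.comp_snd.sub mX'.comp_fst)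
  rw [pot, integral_geninv_eq h1 ha hb hab, integral_geninv_eq h2 hb ha hba,
    ← integral_integral_swap iYX,
    integral_integral iYX, integral_integral iXY, ← integral_add iYX iXY]
  have hone : ∀ p : ℝ × ℝ, Om w (Y p.2 - X p.1) + Om w (X p.1 - Y p.2) = 1 := fun p => by
    rw [← neg_sub, Om_neg hw]; ring
  simp only [hone]
  rw [integral_const, Measure.real, ← univ_prod_univ, Measure.prod_prod]
  simp [ENNReal.toReal_ofReal ha.1, ENNReal.toReal_ofReal hb.1, mul_comm]

end Rigidity

/-- Under the SPGC, `C_w < ∞` and the interval support condition with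
parameter `W`, if `(f₀,g₀)` and `(f₁,g₁)` are consistent fixed points of nondecreasing
interpolating profiles, then there exists `m ∈ ℝ` with `f₁(x) = f₀(x+m)` and
`g₁(x) = g₀(x+m)` for almost all `x`. -/
theorem stmt18 (w hf hg f0 g0 f1 g1 : ℝ → ℝ) (W : ℝ≥0∞) (hW : 0 < W)
    (hw : IsWindow w) (hCw : Integrable (fun x => |x| * w x))
    (hsup : IntervalSupport w W)
    (hhf : IsUpdate hf) (hhg : IsUpdate hg) (hspgc : SPGC hf hg)
    (hf0 : IsProfile f0) (hg0 : IsProfile g0) (hf1 : IsProfile f1) (hg1 : IsProfile g1)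
    (hf0m : Monotone f0) (hg0m : Monotone g0) (hf1m : Monotone f1) (hg1m : Monotone g1)
    (hcfp0 : IsCFP w hf hg f0 g0) (hcfp1 : IsCFP w hf hg f1 g1) :
    ∃ m : ℝ, ∀ᵐ x : ℝ, f1 x = f0 (x + m) ∧ g1 x = g0 (x + m) := by
  have mX0 := aestronglyMeasurable_rinv hf0 hf0m
  have mY0 := aestronglyMeasurable_rinv hg0 hg0m
  have e0f := fun u (hu : u ∈ Ioo (0:ℝ) 1) =>
    hcfp0.integral_Om hw hhf hf0 hg0 hf0m hg0m hu
  have e0g := fun u (hu : u ∈ Ioo (0:ℝ) 1) =>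
    hcfp0.swap.integral_Om hw hhg hg0 hf0 hg0m hf0m hu
  have hOm : ∀ u ∈ Ioo (0:ℝ) 1, ∀ v ∈ Ioo (0:ℝ) 1,
      Om w (rinv f0 u - rinv g0 v) = Om w (rinv f1 u - rinv g1 v) := fun u hu v hv =>
    Om_eq_of_integral_eq hw mX0 mY0
      (aestronglyMeasurable_rinv hf1 hf1m) (aestronglyMeasurable_rinv hg1 hg1m)
      (fun _ => continuousWithinAt_rinv hf0 hf0m) (fun _ => continuousWithinAt_rinv hg0 hg0m)
      (fun _ => continuousWithinAt_rinv hf1 hf1m) (fun _ => continuousWithinAt_rinv hg1 hg1m)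
      (fun u hu => (hcfp1.integral_Om hw hhf hf1 hg1 hf1m hg1m hu).trans (e0f u hu).symm)
      (fun u hu => (hcfp1.swap.integral_Om hw hhg hg1 hf1 hg1m hf1m hu).trans (e0g u hu).symm)
      hu hv
  have hedge : ∀ u ∈ Ioo (0:ℝ) 1, ∀ v ∈ Ioo (0:ℝ) 1,
      ENNReal.ofReal |rinv f0 u - rinv g0 v| < W →
      rinv f1 u - rinv f0 u = rinv g1 v - rinv g0 v := fun u hu v hv huv => by
    linarith [eq_of_Om_eq hw hsup huv (hOm u hu v hv)]
  have hdisp : ∀ u ∈ Ioo (0:ℝ) 1, ∀ v ∈ Ioo (0:ℝ) 1,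
      rinv f1 u - rinv f0 u = rinv g1 v - rinv g0 v := by
    intro u hu v hv
    rcases eq_or_ne W ⊤ with hWtop | hWtop
    · exact hedge u hu v hv (hWtop ▸ ENNReal.ofReal_lt_top)
    refine displacement_eq (R := W.toReal) (monotoneOn_rinv hf0 hf0m) (monotoneOn_rinv hg0 hg0m)
      (fun u hu v hv huv => hedge u hu v hv ((ENNReal.ofReal_lt_iff_lt_toReal (abs_nonneg _)
        hWtop).2 huv)) (fun a ha b hb hab hba => ?_) hu hv
    have hzero : ∀ x, W.toReal < |x| → w x = 0 := fun x hx =>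
      (hsup x).2 ((ENNReal.lt_ofReal_iff_toReal_lt hWtop).2 hx)
    have hpot : pot hf hg b a = 0 := pot_eq_zero_of_cut hw mX0 mY0 e0f e0g ha hb
      (fun u hu v hv h1 h2 => Om_eq_zero hzero (by linarith [hab u hu v hv h1 h2]))
      (fun v hv u hu h1 h2 => Om_eq_zero hzero (by linarith [hba u hu v hv h2 h1]))
    by_contra! hne
    refine (hspgc.2 b hb a ha (fun h => ?_) (fun h => ?_)).ne' hpot
    · exact hne.1 (Prod.ext_iff.1 h).2 (Prod.ext_iff.1 h).1
    · exact hne.2 (Prod.ext_iff.1 h).2 (Prod.ext_iff.1 h).1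
  have hhalf : (1/2 : ℝ) ∈ Ioo (0:ℝ) 1 := by constructor <;> norm_num
  set c := rinv g1 (1/2) - rinv g0 (1/2) with hc
  have hXc : ∀ u ∈ Ioo (0:ℝ) 1, rinv f1 u - rinv f0 u = c := fun u hu => hdisp u hu _ hhalf
  have hYc : ∀ v ∈ Ioo (0:ℝ) 1, rinv g1 v - rinv g0 v = c := fun v hv =>
    (hdisp _ hhalf v hv).symm.trans (hdisp _ hhalf _ hhalf)
  refine ⟨-c, ?_⟩
  filter_upwards [ae_eq_translate_of_rinv_eq_add hf0 hf0m hf1 hf1m hXc,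
    ae_eq_translate_of_rinv_eq_add hg0 hg0m hg1 hg1m hYc] with x h1 h2
  exact ⟨h1, h2⟩

end
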